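/- For every matrix (a b; c d) in SL₂(ℤ) with c ≡ 0 (mod 3) and every τ in the upper half-plane: 𝒜₃((aτ+b)/(cτ+d)) = χ₋₃(d)·(cτ+d)·𝒜₃(τ), ℬ₃((aτ+b)/(cτ+d))³ = χ₋₃(d)·(cτ+d)³·ℬ₃(τ)³, and 𝒞₃((aτ+b)/(cτ+d))³ = χ₋₃(d)·(cτ+d)³·𝒞₃(τ)³; in particular 𝒜₃((aτ+b)/(cτ+d))² = (cτ+d)²·𝒜₃(τ)². -/

import Mathlib

open Complex

noncomputable section

/-- q = exp(2πiτ). -/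
def qq (τ : ℂ) : ℂ := Complex.exp (2 * Real.pi * Complex.I * τ)

/-- The Dedekind eta function η(τ) = exp(πiτ/12)·∏_{n≥1} (1 − qⁿ). -/
def dedekindEta (τ : ℂ) : ℂ :=
  Complex.exp (Real.pi * Complex.I * τ / 12) * ∏' n : ℕ, (1 - qq τ ^ (n + 1))

/-- The Borwein cubic theta function 𝒜₃(τ) = ∑_{n,m∈ℤ} q^{n²+nm+m²}. -/
def A3 (τ : ℂ) : ℂ := ∑' p : ℤ × ℤ, qq τ ^ (p.1 ^ 2 + p.1 * p.2 + p.2 ^ 2)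

/-- ℬ₃(τ) = η(τ)³/η(3τ). -/
def B3 (τ : ℂ) : ℂ := dedekindEta τ ^ 3 / dedekindEta (3 * τ)

/-- 𝒞₃(τ) = 3·η(3τ)³/η(τ). -/
def C3 (τ : ℂ) : ℂ := 3 * dedekindEta (3 * τ) ^ 3 / dedekindEta τ

/-- The quadratic character χ₋₃. -/
def chiNeg3 (d : ℤ) : ℂ := if d % 3 = 1 then 1 else if d % 3 = 2 then -1 else 0

lemma aux_denom_ne {τ : ℂ} (hτ : 0 < τ.im) (c d : ℤ) (h : c ≠ 0 ∨ d ≠ 0) :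
    (c : ℂ) * τ + d ≠ 0 := by
  intro h0
  have him := congrArg Complex.im h0
  have hre := congrArg Complex.re h0
  simp at him hre
  rcases him with hc | ht
  · subst hc
    simp at hre
    simp [hre] at h
  · exact hτ.ne' ht

lemma aux_im {τ : ℂ} (hτ : 0 < τ.im) : 0 < (-1 / (3 * τ)).im := by
  have h0 : τ ≠ 0 := by rintro rfl; simp at hτ
  have h1 : -1 / (3 * τ) = ((1 / 3 : ℝ) : ℂ) * (-(τ⁻¹)) := by
    push_cast
    field_simp
  rw [h1, Complex.im_ofReal_mul, Complex.neg_im, Complex.inv_im, neg_div, neg_neg]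
  have : 0 < Complex.normSq τ := Complex.normSq_pos.mpr h0
  positivity

lemma aux_V (f g : ℂ → ℂ) (k : ℕ) (C : ℂ) (hg : Function.Periodic g 1)
    (hF : ∀ τ : ℂ, 0 < τ.im → f (-1 / (3 * τ)) = C * τ ^ k * g τ)
    (m : ℤ) (σ : ℂ) (hσ : 0 < σ.im) :
    0 < (σ / (3 * m * σ + 1)).im ∧
      f (σ / (3 * m * σ + 1)) = (3 * m * σ + 1) ^ k * f σ := by
  have h0 : σ ≠ 0 := by rintro rfl; simp at hσ
  have h1 : 3 * (m : ℂ) * σ + 1 ≠ 0 := by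
    have := aux_denom_ne hσ (3 * m) 1 (Or.inr one_ne_zero)
    push_cast at this
    exact this
  have hs := aux_im hσ
  set s := -1 / (3 * σ) with hs_def
  have hs0 : s ≠ 0 := by rintro h; rw [h] at hs; simp at hs
  have e1 : s - m = (3 * m * σ + 1) * s := by
    rw [hs_def]; field_simp; ring
  have e2 : σ = -1 / (3 * s) := by
    rw [hs_def]; field_simp
  have e3 : σ / (3 * m * σ + 1) = -1 / (3 * (s - m)) := by
    rw [e1, hs_def]; field_simp
  have him : 0 < (s - m).im := by simpa using hs
  have hgm : g (s - m) = g s := by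
    have := hg.int_mul m (s - m)
    simp at this
    exact this.symm
  refine ⟨by rw [e3]; exact aux_im him, ?_⟩
  have e4 : f σ = C * s ^ k * g s := by rw [← hF s hs, ← e2]
  rw [e3, hF _ him, hgm, e4, e1, mul_pow]
  ring

lemma aux_round (d c : ℤ) (hc : c ≠ 0) : ∃ n : ℤ, 2 * |d - n * c| ≤ |c| := by
  have h1 := Int.emod_add_mul_ediv d c
  have h2 := Int.emod_nonneg d hc
  have h3 := Int.emod_lt_abs d hc
  by_cases h : 2 * (d % c) ≤ |c|
  · refine ⟨d / c, ?_⟩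
    have : d - d / c * c = d % c := by linarith
    rw [this, abs_of_nonneg h2]; exact h
  · rcases le_or_gt 0 c with hc' | hc'
    · refine ⟨d / c + 1, ?_⟩
      rw [abs_of_nonneg hc'] at *
      have : d - (d / c + 1) * c = d % c - c := by linarith
      rw [this, abs_of_nonpos (by linarith)]; linarith
    · refine ⟨d / c - 1, ?_⟩
      rw [abs_of_neg hc'] at *
      have : d - (d / c - 1) * c = d % c + c := by linarith
      rw [this, abs_of_nonpos (by linarith)]; linarith

lemma aux_gen (f g : ℂ → ℂ) (k : ℕ) (hk : Odd k) (C : ℂ) (hf : Function.Periodic f 1)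
    (hg : Function.Periodic g 1)
    (hF : ∀ τ : ℂ, 0 < τ.im → f (-1 / (3 * τ)) = C * τ ^ k * g τ) :
    ∀ (N : ℕ) (a b c d : ℤ), c.natAbs ≤ N → a * d - b * c = 1 → (3 : ℤ) ∣ c →
      ∀ τ : ℂ, 0 < τ.im →
      f (((a : ℂ) * τ + b) / ((c : ℂ) * τ + d)) = chiNeg3 d * ((c : ℂ) * τ + d) ^ k * f τ := by
  have hf' : ∀ (n : ℤ) (z : ℂ), f (z + n) = f z := fun n z => by
    have := hf.int_mul n z
    simpa using this
  have base : ∀ (a b d : ℤ), a * d = 1 → ∀ τ : ℂ,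
      f (((a : ℂ) * τ + b) / (d : ℂ)) = chiNeg3 d * (d : ℂ) ^ k * f τ := by
    intro a b d had τ
    rcases Int.eq_one_or_neg_one_of_mul_eq_one' had with ⟨rfl, rfl⟩ | ⟨rfl, rfl⟩
    · simp [chiNeg3, hf']
    · have := hf' (-b) τ
      have e : chiNeg3 (-1) = -1 := by simp [chiNeg3]
      rw [e]
      push_cast at *
      rw [show ((-1 : ℂ) * τ + b) / (-1) = τ + -b by ring, this, hk.neg_one_pow]
      ring
  intro N
  induction N with
  | zero =>
    intro a b c d hN hdet hc τ hτ
    have : c = 0 := by omega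
    subst this
    have := base a b d (by linarith) τ
    simpa using this
  | succ N ih =>
    intro a b c d hN hdet hc τ hτ
    by_cases hc0 : c = 0
    · subst hc0
      have := base a b d (by linarith) τ
      simpa using this
    obtain ⟨n, hn⟩ := aux_round d c hc0
    obtain ⟨c₀, rfl⟩ := hc
    set d' := d - n * (3 * c₀) with hd'
    have hd0 : d' ≠ 0 := by
      intro h
      have : d = n * (3 * c₀) := by linarith
      rw [this] at hdet
      have : (3 : ℤ) * (a * n * c₀ - b * c₀) = 1 := by linarith
      omega
    obtain ⟨m, hm⟩ := aux_round c₀ d' hd0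
    set c' := c₀ - m * d' with hc'
    set b' := b - n * a with hb'
    set a' := a - 3 * m * b' with ha'
    have hlt : (3 * c').natAbs ≤ N := by
      rw [abs_mul, abs_of_nonneg (by norm_num : (0:ℤ) ≤ 3)] at hn
      have hpos : 0 < |c₀| := abs_pos.mpr (by rintro rfl; simp at hc0)
      have : |c'| < |c₀| := by linarith
      have h5 : c'.natAbs < c₀.natAbs := by
        rw [Int.abs_eq_natAbs, Int.abs_eq_natAbs] at this
        exact_mod_cast this
      omega
    have hdet' : a' * d' - b' * (3 * c') = 1 := by
      rw [ha', hb', hc', hd']; linear_combination hdet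
    have hσ : 0 < (τ + n).im := by simpa using hτ
    obtain ⟨hρ, hfρ⟩ := aux_V f g k C hg hF m (τ + n) hσ
    have key := ih a' b' (3 * c') d' hlt hdet' ⟨c', rfl⟩ _ hρ
    have h1 : 3 * (m : ℂ) * (τ + n) + 1 ≠ 0 := by
      have := aux_denom_ne hσ (3 * m) 1 (Or.inr one_ne_zero)
      push_cast at this
      exact this
    have h2 : (3 * (c₀ : ℂ)) * τ + d ≠ 0 := by
      have := aux_denom_ne hτ (3 * c₀) d (Or.inl hc0)
      push_cast at this
      exact this
    have e1 : ((3 * c' : ℤ) : ℂ) * ((τ + n) / (3 * m * (τ + n) + 1)) + (d' : ℂ)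
        = ((3 * (c₀ : ℂ)) * τ + d) / (3 * m * (τ + n) + 1) := by
      rw [hc', hd']; push_cast; field_simp; ring
    have e2 : (a' : ℂ) * ((τ + n) / (3 * m * (τ + n) + 1)) + (b' : ℂ)
        = (a * τ + b) / (3 * m * (τ + n) + 1) := by
      rw [ha', hb']; push_cast; field_simp; ring
    have e3 : chiNeg3 d' = chiNeg3 d := by
      have : d' % 3 = d % 3 := by
        rw [hd', show d - n * (3 * c₀) = d - 3 * (n * c₀) by ring]; omega
      simp [chiNeg3, this]
    rw [e1, e2, hfρ, hf', e3, div_div_div_cancel_right₀ h1, div_pow] at key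
    push_cast
    rw [key]
    field_simp

lemma aux_eta (τ : ℂ) : dedekindEta τ = ModularForm.eta τ := by
  simp only [dedekindEta, ModularForm.eta, ModularForm.eta_q_eq_pow, qq, Function.Periodic.qParam]
  congr 2
  push_cast
  ring

lemma aux_eta_ne {τ : ℂ} (hτ : 0 < τ.im) : dedekindEta τ ≠ 0 := by
  rw [aux_eta]; exact ModularForm.eta_ne_zero hτ

lemma aux_eta_S {τ : ℂ} (hτ : 0 < τ.im) :
    dedekindEta (-1 / τ) = (Complex.sqrt I)⁻¹ * (Complex.sqrt τ * dedekindEta τ) := by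
  rw [aux_eta, aux_eta]
  simpa using ModularForm.eta_comp_eq_csqrt_I_inv (x := τ) hτ

lemma aux_qq (τ : ℂ) (n : ℕ) : qq (τ + n) = qq τ := by
  unfold qq
  rw [mul_add, Complex.exp_add,
    show 2 * (Real.pi : ℂ) * I * n = n * (2 * Real.pi * I) by ring,
    Complex.exp_nat_mul_two_pi_mul_I, mul_one]

lemma aux_eta_T (τ : ℂ) (n : ℕ) :
    dedekindEta (τ + n) = Complex.exp (Real.pi * I / 12) ^ n * dedekindEta τ := by
  unfold dedekindEta
  rw [aux_qq, ← Complex.exp_nat_mul, ← mul_assoc, ← Complex.exp_add]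
  congr 2
  ring

lemma aux_zeta : Complex.exp (Real.pi * I / 12) ^ 24 = 1 := by
  rw [← Complex.exp_nat_mul, ← Complex.exp_two_pi_mul_I]
  congr 1
  push_cast; ring

lemma aux_sqrt_sq (z : ℂ) : Complex.sqrt z ^ 2 = z := by
  simp [Complex.sqrt, ← Complex.cpow_nat_mul]

lemma aux_cpow (r : ℝ) (hr : 0 < r) (z : ℂ) (w : ℂ) :
    ((r : ℂ) * z) ^ w = (r : ℂ) ^ w * z ^ w := by
  have hr0 : (r : ℂ) ≠ 0 := by exact_mod_cast hr.ne'
  by_cases hz : z = 0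
  · subst hz
    by_cases hw : w = 0
    · simp [hw]
    · simp [hw]
  · rw [Complex.cpow_def_of_ne_zero (mul_ne_zero hr0 hz), Complex.cpow_def_of_ne_zero hr0,
      Complex.cpow_def_of_ne_zero hz, Complex.log_ofReal_mul hr hz, Complex.ofReal_log hr.le,
      ← Complex.exp_add, add_mul]

lemma aux_B_per : Function.Periodic (fun τ => B3 τ ^ 3) 1 := by
  intro τ
  have h1 := aux_eta_T τ 1
  have h3 := aux_eta_T (3 * τ) 3
  push_cast at h1 h3
  have hz : Complex.exp (Real.pi * I / 12) ≠ 0 := Complex.exp_ne_zero _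
  simp only [B3]
  rw [show 3 * (τ + 1) = 3 * τ + 3 by ring, h1, h3]
  rw [pow_one, mul_pow, mul_div_mul_left _ _ (pow_ne_zero 3 hz)]

lemma aux_C_per : Function.Periodic (fun τ => C3 τ ^ 3) 1 := by
  intro τ
  have h1 := aux_eta_T τ 1
  have h3 := aux_eta_T (3 * τ) 3
  push_cast at h1 h3
  have hz : Complex.exp (Real.pi * I / 12) ≠ 0 := Complex.exp_ne_zero _
  simp only [C3]
  rw [show 3 * (τ + 1) = 3 * τ + 3 by ring, h1, h3]
  generalize hw : Complex.exp (Real.pi * I / 12) = w at *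
  have hw24 : w ^ 24 = 1 := hw ▸ aux_zeta
  rw [pow_one, show 3 * (w ^ 3 * dedekindEta (3 * τ)) ^ 3 = w * (w ^ 8 * (3 * dedekindEta (3 * τ) ^ 3)) by ring,
    mul_div_mul_left _ _ hz, mul_div_assoc, mul_pow, ← pow_mul, hw24, one_mul]

lemma aux_sqrt3 (τ : ℂ) :
    Complex.sqrt (3 * τ) = Complex.sqrt 3 * Complex.sqrt τ := by
  have := aux_cpow 3 (by norm_num) τ (2⁻¹)
  simpa [Complex.sqrt] using this

lemma aux_BC : ∃ C : ℂ, ∀ τ : ℂ, 0 < τ.im → B3 (-1 / (3 * τ)) ^ 3 = C * τ ^ 3 * C3 τ ^ 3 := by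
  refine ⟨(Complex.sqrt I)⁻¹ ^ 6 * Complex.sqrt 3 ^ 9 / 27, fun τ hτ => ?_⟩
  have h0 : τ ≠ 0 := by rintro rfl; simp at hτ
  have h3 : 0 < (3 * τ).im := by simpa using hτ
  have hI : (Complex.sqrt I)⁻¹ ≠ 0 := by
    intro h; have := aux_sqrt_sq I; rw [inv_eq_zero.mp h] at this; simp at this
    exact Complex.I_ne_zero this.symm
  have hs : Complex.sqrt τ ≠ 0 := by
    intro h; have := aux_sqrt_sq τ; rw [h] at this; simp at this; exact h0 this.symm
  have e := aux_sqrt_sq τ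
  have n1 := aux_eta_ne hτ
  have n3 := aux_eta_ne h3
  simp only [B3, C3]
  rw [show 3 * (-1 / (3 * τ)) = -1 / τ by field_simp, aux_eta_S hτ, aux_eta_S h3, aux_sqrt3]
  generalize Complex.sqrt τ = t at *
  rw [← e]
  generalize (Complex.sqrt I)⁻¹ = u at *
  field_simp
  ring

lemma aux_CB : ∃ C : ℂ, ∀ τ : ℂ, 0 < τ.im → C3 (-1 / (3 * τ)) ^ 3 = C * τ ^ 3 * B3 τ ^ 3 := by
  refine ⟨27 * (Complex.sqrt I)⁻¹ ^ 6 / Complex.sqrt 3 ^ 3, fun τ hτ => ?_⟩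
  have h0 : τ ≠ 0 := by rintro rfl; simp at hτ
  have h3 : 0 < (3 * τ).im := by simpa using hτ
  have hI : (Complex.sqrt I)⁻¹ ≠ 0 := by
    intro h; have := aux_sqrt_sq I; rw [inv_eq_zero.mp h] at this; simp at this
    exact Complex.I_ne_zero this.symm
  have hs : Complex.sqrt τ ≠ 0 := by
    intro h; have := aux_sqrt_sq τ; rw [h] at this; simp at this; exact h0 this.symm
  have hs3 : Complex.sqrt 3 ≠ 0 := by
    intro h; have := aux_sqrt_sq 3; rw [h] at this; simp at this
  have e := aux_sqrt_sq τ
  have n1 := aux_eta_ne hτ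
  have n3 := aux_eta_ne h3
  simp only [B3, C3]
  rw [show 3 * (-1 / (3 * τ)) = -1 / τ by field_simp, aux_eta_S hτ, aux_eta_S h3, aux_sqrt3]
  generalize Complex.sqrt τ = t at *
  rw [← e]
  generalize (Complex.sqrt I)⁻¹ = u at *
  field_simp
  ring

lemma aux_A_per : Function.Periodic A3 1 := by
  intro τ
  have := aux_qq τ 1
  push_cast at this
  simp [A3, this]

lemma aux_term (τ : ℂ) (k : ℤ) : qq τ ^ k = Complex.exp (2 * Real.pi * I * τ * k) := by
  rw [qq, ← Complex.exp_int_mul]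
  congr 1; ring

lemma aux_summable_theta {t : ℂ} (ht : 0 < t.im) :
    Summable fun n : ℤ => ‖Complex.exp (Real.pi * I * n ^ 2 * t)‖ := by
  have := ((summable_jacobiTheta₂_term_iff 0 t).mpr ht).norm
  simpa [jacobiTheta₂_term] using this

lemma aux_A_summable {τ : ℂ} (hτ : 0 < τ.im) :
    Summable fun p : ℤ × ℤ => qq τ ^ (p.1 ^ 2 + p.1 * p.2 + p.2 ^ 2) := by
  have h := aux_summable_theta hτ
  have h2 := Summable.mul_of_nonneg h h (fun _ => norm_nonneg _) (fun _ => norm_nonneg _)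
  refine Summable.of_norm_bounded h2 fun p => ?_
  rw [aux_term, ← norm_mul, ← Complex.exp_add, Complex.norm_exp, Complex.norm_exp,
    Real.exp_le_exp]
  have e1 : (2 * Real.pi * I * τ * ((p.1 ^ 2 + p.1 * p.2 + p.2 ^ 2 : ℤ) : ℂ)).re
      = -(2 * Real.pi * τ.im) * (p.1 ^ 2 + p.1 * p.2 + p.2 ^ 2 : ℝ) := by
    rw [show 2 * Real.pi * I * τ * ((p.1 ^ 2 + p.1 * p.2 + p.2 ^ 2 : ℤ) : ℂ) =
      ((2 * Real.pi * (p.1 ^ 2 + p.1 * p.2 + p.2 ^ 2 : ℝ) : ℝ) : ℂ) * τ * I by push_cast; ring,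
      Complex.mul_I_re, Complex.im_ofReal_mul]
    ring
  have e2 : (Real.pi * I * p.1 ^ 2 * τ + Real.pi * I * p.2 ^ 2 * τ).re
      = -(2 * Real.pi * τ.im) * ((p.1 ^ 2 + p.2 ^ 2) / 2 : ℝ) := by
    rw [show Real.pi * I * (p.1 : ℂ) ^ 2 * τ + Real.pi * I * p.2 ^ 2 * τ =
      ((Real.pi * (p.1 ^ 2 + p.2 ^ 2 : ℝ) : ℝ) : ℂ) * τ * I by push_cast; ring,
      Complex.mul_I_re, Complex.im_ofReal_mul]
    ring
  rw [e1, e2]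
  have hp : 0 ≤ 2 * Real.pi * τ.im := by positivity
  nlinarith [sq_nonneg ((p.1 : ℝ) + p.2), mul_nonneg hp (sq_nonneg ((p.1 : ℝ) + p.2))]

lemma aux_A_theta {τ : ℂ} (hτ : 0 < τ.im) :
    A3 τ = ∑' m : ℤ, Complex.exp (2 * Real.pi * I * τ * m ^ 2) * jacobiTheta₂ (m * τ) (2 * τ) := by
  rw [A3, (aux_A_summable hτ).tsum_prod]
  refine tsum_congr fun m => ?_
  rw [jacobiTheta₂, ← tsum_mul_left]
  refine tsum_congr fun n => ?_
  rw [aux_term, jacobiTheta₂_term, ← Complex.exp_add]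
  congr 1
  push_cast; ring

lemma aux_A_fricke : ∃ C : ℂ, ∀ τ : ℂ, 0 < τ.im → A3 (-1 / (3 * τ)) = C * τ ^ 1 * A3 τ := by
  refine ⟨((2 : ℝ) : ℂ) ^ (1 / 2 : ℂ) * ((3 / 2 : ℝ) : ℂ) ^ (1 / 2 : ℂ) * (-I), fun τ hτ => ?_⟩
  have h0 : τ ≠ 0 := by rintro rfl; simp at hτ
  have hσ := aux_im hτ
  set σ := -1 / (3 * τ) with hσd
  have hinv : 0 < (-1 / (2 * τ)).im := by
    rw [show -1 / (2 * τ) = ((3 / 2 : ℝ) : ℂ) * σ by rw [hσd]; push_cast; field_simp,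
      Complex.im_ofReal_mul]
    positivity
  have h32 : 0 < (3 * τ / 2).im := by
    rw [show 3 * τ / 2 = ((3 / 2 : ℝ) : ℂ) * τ by push_cast; ring, Complex.im_ofReal_mul]
    positivity
  set K₁ := (-I * (2 * τ)) ^ (1 / 2 : ℂ) with hK₁
  set K₂ := (-I * (3 * τ / 2)) ^ (1 / 2 : ℂ) with hK₂
  have hK : K₁ * K₂ = ((2 : ℝ) : ℂ) ^ (1 / 2 : ℂ) * ((3 / 2 : ℝ) : ℂ) ^ (1 / 2 : ℂ) * (-I) * τ ^ 1 := by
    rw [hK₁, hK₂, show -I * (2 * τ) = ((2 : ℝ) : ℂ) * (-I * τ) by push_cast; ring,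
      show -I * (3 * τ / 2) = ((3 / 2 : ℝ) : ℂ) * (-I * τ) by push_cast; ring,
      aux_cpow _ (by norm_num), aux_cpow _ (by norm_num)]
    have : (-I * τ) ^ (1 / 2 : ℂ) * (-I * τ) ^ (1 / 2 : ℂ) = -I * τ := by
      have := aux_sqrt_sq (-I * τ)
      rw [Complex.sqrt, sq] at this
      simpa using this
    linear_combination (((2 : ℝ) : ℂ) ^ (1 / 2 : ℂ) * ((3 / 2 : ℝ) : ℂ) ^ (1 / 2 : ℂ)) * this
  have hK₁0 : K₁ ≠ 0 := by
    rw [hK₁]; simp [Complex.cpow_eq_zero_iff, h0]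
  have hK₂0 : K₂ ≠ 0 := by
    rw [hK₂]; simp [Complex.cpow_eq_zero_iff, h0]
  rw [← hK]
  -- the intermediate double sum
  let F : ℤ → ℤ → ℂ := fun m n =>
    Complex.exp (Real.pi * I * m ^ 2 * (3 * τ / 2)) * (Complex.exp (Real.pi * I * n * m) *
      Complex.exp (Real.pi * I * n ^ 2 * (-1 / (2 * τ))))
  have hFs : Summable (Function.uncurry F) := by
    have h2 := Summable.mul_of_nonneg (aux_summable_theta h32) (aux_summable_theta hinv)
      (fun _ => norm_nonneg _) (fun _ => norm_nonneg _)
    refine Summable.of_norm_bounded h2 fun p => ?_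
    have : ‖Complex.exp (Real.pi * I * p.2 * p.1)‖ = 1 := by
      rw [show (Real.pi : ℂ) * I * p.2 * p.1 = ((Real.pi * p.2 * p.1 : ℝ) : ℂ) * I by
        push_cast; ring, Complex.norm_exp_ofReal_mul_I]
    simp [Function.uncurry, F, this]
  have s1 : K₁ * A3 τ = ∑' m : ℤ, ∑' n : ℤ, F m n := by
    rw [aux_A_theta hτ, ← tsum_mul_left]
    refine tsum_congr fun m => ?_
    rw [jacobiTheta₂_functional_equation, ← hK₁]
    have : K₁ * (Complex.exp (2 * Real.pi * I * τ * m ^ 2) *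
        (1 / K₁ * Complex.exp (-Real.pi * I * (m * τ) ^ 2 / (2 * τ)) *
          jacobiTheta₂ (m * τ / (2 * τ)) (-1 / (2 * τ)))) =
        Complex.exp (2 * Real.pi * I * τ * m ^ 2) *
          Complex.exp (-Real.pi * I * (m * τ) ^ 2 / (2 * τ)) *
          jacobiTheta₂ (m * τ / (2 * τ)) (-1 / (2 * τ)) := by
      field_simp
    rw [this, jacobiTheta₂, ← tsum_mul_left]
    refine tsum_congr fun n => ?_
    simp only [F, jacobiTheta₂_term, ← Complex.exp_add]
    congr 1
    field_simp
    ring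
  have s2 : ∑' n : ℤ, ∑' m : ℤ, F m n = 1 / K₂ * A3 σ := by
    rw [aux_A_theta hσ, ← tsum_mul_left]
    refine tsum_congr fun n => ?_
    have e1 : ∑' m : ℤ, F m n = Complex.exp (Real.pi * I * n ^ 2 * (-1 / (2 * τ))) *
        jacobiTheta₂ (n / 2) (3 * τ / 2) := by
      rw [jacobiTheta₂, ← tsum_mul_left]
      refine tsum_congr fun m => ?_
      simp only [F, jacobiTheta₂_term, ← Complex.exp_add]
      congr 1
      ring
    rw [e1, jacobiTheta₂_functional_equation, ← hK₂, ← jacobiTheta₂_neg_left (n * σ)]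
    have e2 : (n : ℂ) / 2 / (3 * τ / 2) = -(n * σ) := by
      rw [hσd]; field_simp
    have e3 : -1 / (3 * τ / 2) = 2 * σ := by
      rw [hσd]; field_simp
    have e4 : Complex.exp (2 * Real.pi * I * σ * n ^ 2) =
        Complex.exp (Real.pi * I * n ^ 2 * (-1 / (2 * τ))) *
        Complex.exp (-Real.pi * I * (n / 2) ^ 2 / (3 * τ / 2)) := by
      rw [← Complex.exp_add, hσd]
      congr 1
      field_simp
      ring
    rw [e2, e3, e4]
    ring
  have s3 : ∑' m : ℤ, ∑' n : ℤ, F m n = ∑' n : ℤ, ∑' m : ℤ, F m n := hFs.tsum_comm.symm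
  rw [s3, s2] at s1
  rw [mul_right_comm, s1]
  field_simp


theorem signature3_modularity_on_Gamma0_3
    (a b c d : ℤ) (hdet : a * d - b * c = 1) (hc : (3 : ℤ) ∣ c)
    (τ : ℂ) (hτ : 0 < τ.im) :
    A3 (((a : ℂ) * τ + b) / ((c : ℂ) * τ + d)) =
      chiNeg3 d * ((c : ℂ) * τ + d) * A3 τ ∧
    B3 (((a : ℂ) * τ + b) / ((c : ℂ) * τ + d)) ^ 3 =
      chiNeg3 d * ((c : ℂ) * τ + d) ^ 3 * B3 τ ^ 3 ∧
    C3 (((a : ℂ) * τ + b) / ((c : ℂ) * τ + d)) ^ 3 =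
      chiNeg3 d * ((c : ℂ) * τ + d) ^ 3 * C3 τ ^ 3 ∧
    A3 (((a : ℂ) * τ + b) / ((c : ℂ) * τ + d)) ^ 2 =
      ((c : ℂ) * τ + d) ^ 2 * A3 τ ^ 2 := by

  obtain ⟨CA, hA⟩ := aux_A_fricke
  obtain ⟨CB, hB⟩ := aux_BC
  obtain ⟨CC, hC⟩ := aux_CB
  have rA := aux_gen A3 A3 1 odd_one CA aux_A_per aux_A_per hA _ a b c d le_rfl hdet hc τ hτ
  have rB := aux_gen (fun τ => B3 τ ^ 3) (fun τ => C3 τ ^ 3) 3 (by decide) CB aux_B_per aux_C_per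
    hB _ a b c d le_rfl hdet hc τ hτ
  have rC := aux_gen (fun τ => C3 τ ^ 3) (fun τ => B3 τ ^ 3) 3 (by decide) CC aux_C_per aux_B_per
    hC _ a b c d le_rfl hdet hc τ hτ
  rw [pow_one] at rA
  refine ⟨rA, rB, rC, ?_⟩
  have hd : d % 3 = 1 ∨ d % 3 = 2 := by
    obtain ⟨c₀, rfl⟩ := hc
    by_contra hcon
    have h3 : d % 3 = 0 := by omega
    obtain ⟨e, rfl⟩ := Int.dvd_of_emod_eq_zero h3
    have : 3 * (a * e - b * c₀) = 1 := by linarith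
    omega
  have hchi : chiNeg3 d ^ 2 = 1 := by
    rcases hd with h | h <;> simp [chiNeg3, h]
  rw [rA, mul_pow, mul_pow, hchi, one_mul]
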